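/- Let R be a commutative ring, let m be an odd positive integer, and let T be an m×m skew-symmetric matrix over R with zeros on the diagonal. Then for every i, h, s, k, j ∈ {1,…,m} with j ∉ {i,h,s,k}: Σ_{r=1}^{m} σ_{i,r,h} · σ_{i,r,h,s,k} · T_{j,r} · pf_{î,r̂,ĥ,ŝ,k̂}(T) = 0. -/

import Mathlib

open Finset

/-- The unit step (Heaviside) function on the integers. -/
def theta (x : ℤ) : ℕ := if 0 < x then 1 else 0

/-- `σ_{i,j,r}` for (1-based) labels `i j r`. -/
def sigma3 (i j r : ℕ) : ℤ :=
  if i ≠ j ∧ i ≠ r ∧ j ≠ r then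
    (-1) ^ (i + j + r + 1 + theta ((r : ℤ) - (i : ℤ)) + theta ((r : ℤ) - (j : ℤ)) +
      theta ((j : ℤ) - (i : ℤ)))
  else 0

/-- `σ_{i,j,r,h,k}` for (1-based) labels. -/
def sigma5 (i j r h k : ℕ) : ℤ :=
  if i ≠ j ∧ i ≠ r ∧ i ≠ h ∧ i ≠ k ∧ j ≠ r ∧ j ≠ h ∧ j ≠ k ∧ r ≠ h ∧ r ≠ k ∧ h ≠ k then
    (-1) ^ (h + k + 1 + theta ((k : ℤ) - (i : ℤ)) + theta ((k : ℤ) - (j : ℤ)) +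
      theta ((k : ℤ) - (r : ℤ)) + theta ((k : ℤ) - (h : ℤ)) + theta ((h : ℤ) - (i : ℤ)) +
      theta ((h : ℤ) - (j : ℤ)) + theta ((h : ℤ) - (r : ℤ)))
  else 0

/-- The successor of `i` in `Fin N` (with wraparound, which is irrelevant in our uses). -/
def finNext {N : ℕ} (i : Fin N) : Fin N :=
  ⟨(i.1 + 1) % N, Nat.mod_lt _ (Nat.lt_of_le_of_lt (Nat.zero_le _) i.2)⟩

/-- The pfaffian of an `N × N` matrix, as the sum over all partitions of `Fin N` into
two-element blocks (encoded by the permutations `σ` with `σ 0 < σ 1`, `σ 2 < σ 3`, …,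
`σ 0 < σ 2 < σ 4 < ⋯`) of the sign of the permutation times the product of the entries
of `M` at the blocks.  It is `0` when `N` is odd and `1` when `N = 0`. -/
noncomputable def pfAux {R : Type*} [CommRing R] {N : ℕ} (M : Matrix (Fin N) (Fin N) R) : R :=
  if N % 2 = 0 then
    ∑ σ ∈ Finset.univ.filter (fun σ : Equiv.Perm (Fin N) =>
        (∀ i : Fin N, (i : ℕ) % 2 = 0 → σ i < σ (finNext i)) ∧
        (∀ i j : Fin N, (i : ℕ) % 2 = 0 → (j : ℕ) % 2 = 0 → i < j → σ i < σ j)),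
      ((Equiv.Perm.sign σ : ℤ) : R) *
        ∏ i ∈ Finset.univ.filter (fun i : Fin N => (i : ℕ) % 2 = 0), M (σ i) (σ (finNext i))
  else 0

/-- The pfaffian of the submatrix of `T` on the rows and columns indexed by the finset `S`
(taken in increasing order). -/
noncomputable def pfSub {R : Type*} [CommRing R] {m : ℕ} (T : Matrix (Fin m) (Fin m) R)
    (S : Finset (Fin m)) : R :=
  pfAux (fun a b : Fin S.card => T ((S.orderIsoOfFin rfl a : Fin m)) ((S.orderIsoOfFin rfl b : Fin m)))

/-- `pfDel T l` is the pfaffian of the submatrix of `T` obtained by deleting the rows and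
columns indexed by the list `l`, set to `0` if `l` has a repeated entry. -/
noncomputable def pfDel {R : Type*} [CommRing R] {m : ℕ} (T : Matrix (Fin m) (Fin m) R)
    (l : List (Fin m)) : R :=
  if l.Nodup then pfSub T (Finset.univ \ l.toFinset) else 0

section PerfectMatchings

open Equiv Equiv.Perm

/-- The permutation of `Fin (n + 2)` sending `0` to `0`, `1` to `b + 1`, and the remaining
elements, via `τ`, to the remaining elements. -/
def prependPair {n : ℕ} (b : Fin (n + 1)) (τ : Perm (Fin n)) : Perm (Fin (n + 2)) :=
  decomposeFin.symm (0, b.cycleRange⁻¹ * decomposeFin.symm (0, τ))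

lemma prependPair_zero {n : ℕ} (b : Fin (n + 1)) (τ : Perm (Fin n)) :
    prependPair b τ 0 = 0 := by
  simp [prependPair]

lemma prependPair_one {n : ℕ} (b : Fin (n + 1)) (τ : Perm (Fin n)) :
    prependPair b τ (Fin.succ 0) = b.succ := by
  rw [prependPair, decomposeFin_symm_apply_succ]
  simp [Perm.inv_def]

lemma prependPair_succ_succ {n : ℕ} (b : Fin (n + 1)) (τ : Perm (Fin n)) (i : Fin n) :
    prependPair b τ i.succ.succ = (b.succAbove (τ i)).succ := by
  rw [prependPair, decomposeFin_symm_apply_succ]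
  simp [Perm.inv_def]

lemma sign_prependPair {n : ℕ} (b : Fin (n + 1)) (τ : Perm (Fin n)) :
    sign (prependPair b τ) = (-1) ^ (b : ℕ) * sign τ := by
  simp [prependPair, decomposeFin.symm_sign]

lemma exists_prependPair_eq {n : ℕ} {σ : Perm (Fin (n + 2))} (hσ : σ 0 = 0) :
    ∃ b τ, prependPair b τ = σ := by
  obtain ⟨⟨p, e⟩, rfl⟩ := decomposeFin.symm.surjective σ
  obtain rfl : p = 0 := by simpa using hσ
  obtain ⟨⟨q, τ⟩, hq⟩ := decomposeFin.symm.surjective ((e 0).cycleRange * e)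
  obtain rfl : q = 0 := by
    have := congrArg (fun f : Perm (Fin (n + 1)) => f 0) hq
    simpa using this
  exact ⟨e 0, τ, by rw [prependPair, hq, inv_mul_cancel_left]⟩

lemma prependPair_injective {n : ℕ} :
    Function.Injective fun x : Fin (n + 1) × Perm (Fin n) => prependPair x.1 x.2 := by
  rintro ⟨b, τ⟩ ⟨c, υ⟩ h
  obtain rfl : b = c := by
    have := congrArg (fun f : Perm (Fin (n + 2)) => f (Fin.succ 0)) h
    simpa only [prependPair_one, Fin.succ_inj] using this
  refine Prod.ext rfl (Equiv.ext fun i => ?_)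
  have := congrArg (fun f : Perm (Fin (n + 2)) => f i.succ.succ) h
  simpa only [prependPair_succ_succ, Fin.succ_inj, Fin.succAbove_right_inj] using this

lemma finNext_zero {n : ℕ} : finNext (0 : Fin (n + 2)) = Fin.succ 0 := by
  ext; simp [finNext]

lemma val_succ_succ_mod_two {n : ℕ} (i : Fin n) : (i.succ.succ : ℕ) % 2 = (i : ℕ) % 2 := by
  simp only [Fin.val_succ]; omega

lemma finNext_succ_succ {n : ℕ} (hn : Even n) (i : Fin n) (hi : (i : ℕ) % 2 = 0) :
    finNext i.succ.succ = (finNext i).succ.succ := by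
  have := i.2
  have : (i : ℕ) + 1 < n := by grind
  ext
  simp only [finNext, Fin.val_succ]
  rw [Nat.mod_eq_of_lt this, Nat.mod_eq_of_lt (by omega)]

/-- The permutations `σ` with `σ 0 < σ 1`, `σ 2 < σ 3`, … and `σ 0 < σ 2 < σ 4 < ⋯`, which
encode the perfect matchings of `Fin N`. -/
def IsMatchingPerm {N : ℕ} (σ : Perm (Fin N)) : Prop :=
  (∀ i : Fin N, (i : ℕ) % 2 = 0 → σ i < σ (finNext i)) ∧
    (∀ i j : Fin N, (i : ℕ) % 2 = 0 → (j : ℕ) % 2 = 0 → i < j → σ i < σ j)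

lemma IsMatchingPerm.apply_zero {n : ℕ} {σ : Perm (Fin (n + 2))}
    (hσ : IsMatchingPerm σ) : σ 0 = 0 := by
  by_contra h0
  have key : ∀ i : Fin (n + 2), (i : ℕ) % 2 = 0 → σ 0 ≤ σ i := by
    intro i hi
    rcases eq_or_ne i 0 with rfl | hne
    · rfl
    · exact (hσ.2 0 i rfl hi (Fin.pos_of_ne_zero hne)).le
  have hpos : ∀ i, σ 0 ≤ σ i := by
    intro i
    rcases Nat.mod_two_eq_zero_or_one i with hi | hi
    · exact key i hi
    · have hi' : ((⟨i - 1, by omega⟩ : Fin (n + 2)) : ℕ) % 2 = 0 := by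
        simp only; omega
      have h := hσ.1 _ hi'
      have hnext : finNext (⟨i - 1, by omega⟩ : Fin (n + 2)) = i := by
        ext
        simp only [finNext]
        rw [Nat.mod_eq_of_lt (by omega)]
        omega
      rw [hnext] at h
      exact (key _ hi').trans h.le
  have := hpos (σ.symm 0)
  rw [Equiv.apply_symm_apply] at this
  exact h0 (Fin.le_zero_iff.mp this)

lemma isMatchingPerm_prependPair {n : ℕ} (hn : Even n) (b : Fin (n + 1)) (τ : Perm (Fin n)) :
    IsMatchingPerm (prependPair b τ) ↔ IsMatchingPerm τ := by
  have hlt (i j : Fin n) :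
      prependPair b τ i.succ.succ < prependPair b τ j.succ.succ ↔ τ i < τ j := by
    rw [prependPair_succ_succ, prependPair_succ_succ, Fin.succ_lt_succ_iff,
      (Fin.strictMono_succAbove b).lt_iff_lt]
  constructor
  · refine fun h => ⟨fun i hi => ?_, fun i j hi hj hij => ?_⟩
    · rw [← hlt, ← finNext_succ_succ hn i hi]
      exact h.1 _ (by rwa [val_succ_succ_mod_two])
    · rw [← hlt]
      exact h.2 _ _ (by rwa [val_succ_succ_mod_two]) (by rwa [val_succ_succ_mod_two])
        (by simpa using hij)
  · refine fun h => ⟨fun i => ?_, fun i j => ?_⟩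
    · refine Fin.cases (fun _ => ?_) (fun i => Fin.cases (fun hi => ?_) (fun i hi => ?_) i) i
      · rw [finNext_zero, prependPair_zero, prependPair_one]
        exact Fin.succ_pos _
      · simp at hi
      · have hi' : (i : ℕ) % 2 = 0 := by rwa [val_succ_succ_mod_two] at hi
        rw [finNext_succ_succ hn i hi', hlt]
        exact h.1 i hi'
    · refine Fin.cases (fun _ _ hij => ?_) (fun i => ?_) i
      · rw [prependPair_zero]
        refine Fin.pos_of_ne_zero fun h0 => hij.ne' ?_
        exact (prependPair b τ).injective (h0.trans (prependPair_zero b τ).symm)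
      · refine Fin.cases (fun hi => by simp at hi) (fun i hi => ?_) i
        refine Fin.cases (fun _ hij => absurd hij (Fin.not_lt_zero _)) (fun j => ?_) j
        refine Fin.cases (fun hj => by simp at hj) (fun j hj hij => ?_) j
        rw [hlt]
        rw [val_succ_succ_mod_two] at hi hj
        exact h.2 i j hi hj (by simpa using hij)

/-- Expansion of the pfaffian along the first row. -/
lemma pfAux_succ_succ {R : Type*} [CommRing R] {n : ℕ} (hn : Even n)
    (M : Matrix (Fin (n + 2)) (Fin (n + 2)) R) :
    pfAux M = ∑ b : Fin (n + 1), (-1) ^ (b : ℕ) * M 0 b.succ *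
      pfAux (M.submatrix (fun x => (b.succAbove x).succ) fun x => (b.succAbove x).succ) := by
  have h0 : n % 2 = 0 := Nat.even_iff.mp hn
  have h2 : (n + 2) % 2 = 0 := by omega
  simp only [pfAux, h0, h2, if_true, mul_sum, Matrix.submatrix_apply]
  rw [← sum_product' univ]
  symm
  refine sum_bij (fun x _ => prependPair x.1 x.2) ?_ (fun _ _ _ _ h => prependPair_injective h)
    ?_ ?_
  · rintro ⟨b, τ⟩ h
    simp only [mem_product, mem_univ, mem_filter, true_and] at h ⊢
    exact (isMatchingPerm_prependPair hn b τ).mpr h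
  · intro σ hσ
    replace hσ : IsMatchingPerm σ := (mem_filter.mp hσ).2
    obtain ⟨b, τ, rfl⟩ := exists_prependPair_eq hσ.apply_zero
    refine ⟨(b, τ), ?_, rfl⟩
    simp only [mem_product, mem_univ, mem_filter, true_and]
    exact (isMatchingPerm_prependPair hn b τ).mp hσ
  · rintro ⟨b, τ⟩ -
    simp only [sign_prependPair, prod_filter]
    rw [Fin.prod_univ_succ, Fin.prod_univ_succ, finNext_zero, prependPair_zero, prependPair_one]
    have hprod : (∏ i : Fin n, if (i.succ.succ : ℕ) % 2 = 0 then
          M (prependPair b τ i.succ.succ) (prependPair b τ (finNext i.succ.succ)) else 1) =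
        ∏ i : Fin n, if (i : ℕ) % 2 = 0 then
          M (b.succAbove (τ i)).succ (b.succAbove (τ (finNext i))).succ else 1 := by
      refine prod_congr rfl fun i _ => ?_
      rw [val_succ_succ_mod_two]
      split_ifs with hi
      · rw [finNext_succ_succ hn i hi, prependPair_succ_succ, prependPair_succ_succ]
      · rfl
    rw [hprod]
    simp
    ring

end PerfectMatchings

section Signs

variable (R : Type*) [CommRing R] {α : Type*} [LinearOrder α]

/-- `1` if `x ≤ y` and `-1` if `y < x`. -/
def orderSign (x y : α) : R := if y < x then -1 else 1

/-- `(-1) ^ p`, where `p` is the number of elements of `S` below `x`. -/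
def posSign (S : Finset α) (x : α) : R := (-1) ^ #{y ∈ S | y < x}

variable {R}

lemma orderSign_swap {x y : α} (h : x ≠ y) : orderSign R x y = -orderSign R y x := by
  rcases lt_or_gt_of_ne h with h | h <;> simp [orderSign, h, h.not_gt]

lemma posSign_erase {S : Finset α} {y : α} (hy : y ∈ S) (x : α) :
    posSign R (S.erase y) x = posSign R S x * orderSign R x y := by
  unfold posSign orderSign
  rw [filter_erase]
  split_ifs with h
  · have hmem : y ∈ S.filter (· < x) := mem_filter.mpr ⟨hy, h⟩
    rw [← card_erase_add_one hmem, pow_succ]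
    simp
  · rw [erase_eq_of_notMem (by simp [h]), mul_one]

end Signs

section Finset

variable {R : Type*} [CommRing R]

lemma sum_sum_erase_eq_zero {α : Type*} [DecidableEq α] (A : Finset α) (g : α → α → R)
    (hg : ∀ x ∈ A, ∀ y ∈ A, x ≠ y → g x y = -g y x) :
    ∑ x ∈ A, ∑ y ∈ A.erase x, g x y = 0 := by
  rw [sum_sigma']
  refine sum_involution (fun p _ => ⟨p.2, p.1⟩) ?_ ?_ ?_ ?_
  · rintro ⟨x, y⟩ h
    simp only [mem_sigma, mem_erase] at h
    simp [hg x h.1 y h.2.2 h.2.1.symm]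
  · rintro ⟨x, y⟩ h _ heq
    simp only [mem_sigma, mem_erase] at h
    simp only [Sigma.mk.injEq] at heq
    exact h.2.1 heq.1
  · rintro ⟨x, y⟩ h
    simp only [mem_sigma, mem_erase] at h ⊢
    exact ⟨h.2.2, h.2.1.symm, h.1⟩
  · simp

variable {m : ℕ} (T : Matrix (Fin m) (Fin m) R)

lemma pfSub_eq_pfAux {n : ℕ} {S : Finset (Fin m)} {f : Fin n → Fin m} (hf : StrictMono f)
    (hS : univ.image f = S) : pfSub T S = pfAux (T.submatrix f f) := by
  obtain rfl : n = #S := by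
    rw [← hS, card_image_of_injective _ hf.injective, card_univ, Fintype.card_fin]
  have : f = S.orderEmbOfFin rfl :=
    orderEmbOfFin_unique rfl (fun x => hS ▸ mem_image_of_mem f (mem_univ x)) hf
  rw [this]
  rfl

/-- Expansion of the pfaffian of a submatrix along its first row. -/
lemma pfSub_eq_sum_min {S : Finset (Fin m)} (hS : Even #S) {a : Fin m} (ha : a ∈ S)
    (hmin : ∀ x ∈ S, a ≤ x) :
    pfSub T S = ∑ b ∈ S.erase a,
      posSign R (S.erase a) b * T a b * pfSub T ((S.erase a).erase b) := by
  obtain ⟨n, hn⟩ : ∃ n, #S = n + 2 := by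
    have := card_pos.mpr ⟨a, ha⟩
    exact ⟨#S - 2, by grind⟩
  have hn2 : Even n := by grind
  set f := S.orderEmbOfFin hn
  have hf : StrictMono f := f.strictMono
  have hfS : univ.image f = S := image_orderEmbOfFin_univ S hn
  have hfa : f 0 = a := by
    refine le_antisymm ?_ (hmin _ (orderEmbOfFin_mem S hn 0))
    obtain ⟨x, -, rfl⟩ := mem_image.mp (hfS ▸ ha)
    exact hf.monotone (Fin.zero_le x)
  have herase : S.erase a = univ.image fun c : Fin (n + 1) => f c.succ := by
    ext x
    simp only [← hfS, ← hfa, mem_erase, mem_image, mem_univ, true_and]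
    constructor
    · rintro ⟨hne, y, rfl⟩
      obtain ⟨c, rfl⟩ := Fin.exists_succ_eq.mpr (fun h : y = 0 => hne (h ▸ rfl))
      exact ⟨c, rfl⟩
    · rintro ⟨c, rfl⟩
      exact ⟨fun h => Fin.succ_ne_zero c (hf.injective h), _, rfl⟩
  have hg : StrictMono fun c : Fin (n + 1) => f c.succ := hf.comp Fin.strictMono_succ
  rw [pfSub_eq_pfAux T hf hfS, pfAux_succ_succ hn2, herase, sum_image hg.injective.injOn]
  refine sum_congr rfl fun b _ => ?_
  congr 1
  · rw [Matrix.submatrix_apply, hfa, posSign]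
    congr 2
    rw [filter_image, card_image_of_injective _ hg.injective]
    simp only [hg.lt_iff_lt, filter_gt_eq_Iio, Fin.card_Iio]
  · symm
    refine pfSub_eq_pfAux T (f := fun x => f (b.succAbove x).succ)
      (hg.comp (Fin.strictMono_succAbove b)) ?_
    ext x
    simp only [mem_erase, mem_image, mem_univ, true_and]
    constructor
    · rintro ⟨y, rfl⟩
      exact ⟨fun h => Fin.succAbove_ne b y (hg.injective h), _, rfl⟩
    · rintro ⟨hne, c, rfl⟩
      obtain ⟨y, rfl⟩ := Fin.exists_succAbove_eq (fun h : c = b => hne (h ▸ rfl))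
      exact ⟨y, rfl⟩

/-- Expansion of the pfaffian of a submatrix along an arbitrary row. -/
lemma pfSub_eq_sum (hskew : ∀ a b, T b a = -T a b) {S : Finset (Fin m)} (hS : Even #S)
    {j : Fin m} (hj : j ∈ S) :
    pfSub T S = posSign R S j * ∑ b ∈ S.erase j,
      posSign R (S.erase j) b * T j b * pfSub T ((S.erase j).erase b) := by
  obtain ⟨c, hc⟩ : ∃ c, #S = c := ⟨_, rfl⟩
  induction c using Nat.strong_induction_on generalizing S j with
  | _ c ih =>
  subst hc
  obtain ⟨a, ha, hmin⟩ : ∃ a ∈ S, ∀ x ∈ S, a ≤ x := S.exists_min_image id ⟨j, hj⟩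
  have hpos : posSign R S a = 1 := by
    rw [posSign, filter_false_of_mem fun x hx => (hmin x hx).not_gt]
    simp
  rcases eq_or_ne j a with rfl | hja
  · rw [hpos, one_mul]
    exact pfSub_eq_sum_min T hS ha hmin
  have hjSa : j ∈ S.erase a := mem_erase.mpr ⟨hja, hj⟩
  have haSj : a ∈ S.erase j := mem_erase.mpr ⟨hja.symm, ha⟩
  have heven : ∀ x ∈ S, ∀ y ∈ S.erase x, Even #((S.erase x).erase y) := by
    intro x hx y hy
    rw [card_erase_of_mem hy, card_erase_of_mem hx, Nat.sub_sub]
    grind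
  rw [pfSub_eq_sum_min T hS ha hmin, ← add_sum_erase _ _ hjSa, ← add_sum_erase _ _ haSj, mul_add]
  congr 1
  · rw [erase_right_comm, posSign_erase ha, posSign_erase hj, hpos, hskew j a, orderSign_swap hja]
    ring
  · have hleft : ∀ b ∈ (S.erase a).erase j,
        posSign R (S.erase a) b * T a b * pfSub T ((S.erase a).erase b) =
        ∑ r ∈ ((S.erase a).erase j).erase b,
          posSign R (S.erase a) b * T a b * (posSign R ((S.erase a).erase b) j *
          (posSign R (((S.erase a).erase b).erase j) r * T j r *
            pfSub T ((((S.erase a).erase b).erase j).erase r))) := by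
      intro b hb
      obtain ⟨hbj, hb⟩ := mem_erase.mp hb
      have hj' : j ∈ (S.erase a).erase b := mem_erase.mpr ⟨hbj.symm, hjSa⟩
      have hlt : #((S.erase a).erase b) < #S :=
        card_lt_card ((erase_ssubset hb).trans (erase_ssubset ha))
      rw [ih _ hlt (heven a ha b hb) hj' rfl, erase_right_comm (a := j), mul_sum, mul_sum]
    have hright : ∀ r ∈ (S.erase j).erase a,
        posSign R (S.erase j) r * T j r * pfSub T ((S.erase j).erase r) =
        ∑ b ∈ ((S.erase j).erase a).erase r,
          posSign R (S.erase j) r * T j r *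
          (posSign R (((S.erase j).erase r).erase a) b * T a b *
            pfSub T ((((S.erase j).erase r).erase a).erase b)) := by
      intro r hr
      obtain ⟨hra, hr⟩ := mem_erase.mp hr
      have ha' : a ∈ (S.erase j).erase r := mem_erase.mpr ⟨hra.symm, haSj⟩
      rw [pfSub_eq_sum_min T (heven j hj r hr) ha'
        (fun x hx => hmin x (mem_of_mem_erase (mem_of_mem_erase hx))),
        erase_right_comm (a := a), mul_sum]
    rw [sum_congr rfl hleft, sum_congr rfl hright, mul_sum]
    simp only [mul_sum]
    rw [sum_comm' (t' := (S.erase j).erase a) (s' := fun r => ((S.erase j).erase a).erase r)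
      (by intro x y; simp only [mem_erase]; tauto)]
    refine sum_congr rfl fun r hr => sum_congr rfl fun b hb => ?_
    simp only [mem_erase] at hr hb
    obtain ⟨hra, hrj, hrS⟩ := hr
    obtain ⟨hbr, hba, hbj, hbS⟩ := hb
    have hset : (((S.erase a).erase b).erase j).erase r =
        (((S.erase j).erase r).erase a).erase b := by
      ext x; simp only [mem_erase]; tauto
    rw [hset]
    have hsign : posSign R (S.erase a) b * (posSign R ((S.erase a).erase b) j *
          posSign R (((S.erase a).erase b).erase j) r) =
        posSign R S j * (posSign R (S.erase j) r * posSign R (((S.erase j).erase r).erase a) b) := by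
      rw [posSign_erase (y := j) (x := r) (by simp [*, hbj.symm]),
        posSign_erase (y := b) (x := r) (by simp [*]), posSign_erase (y := a) (x := r) ha,
        posSign_erase (y := b) (x := j) (by simp [*]), posSign_erase (y := a) (x := j) ha,
        posSign_erase (y := a) (x := b) ha,
        posSign_erase (y := a) (x := b) (by simp [*, hra.symm]),
        posSign_erase (y := r) (x := b) (by simp [*]),
        posSign_erase (y := j) (x := b) hj, posSign_erase (y := j) (x := r) hj]
      have hja' : orderSign R j a = -1 := by
        simp [orderSign, lt_of_le_of_ne (hmin j hj) hja.symm]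
      have hra' : orderSign R r a = -1 := by
        simp [orderSign, lt_of_le_of_ne (hmin r hrS) hra.symm]
      rw [hja', hra', orderSign_swap hbr, orderSign_swap hbj]
      ring
    linear_combination (T a b * T j r * pfSub T ((((S.erase j).erase r).erase a).erase b)) * hsign

/-- Expanding along a row of the wrong index gives zero. -/
lemma sum_posSign_mul_pfSub_erase_eq_zero (hskew : ∀ a b, T b a = -T a b)
    (hdiag : ∀ a, T a a = 0) {S : Finset (Fin m)} (hS : Odd #S) {j : Fin m} (hj : j ∈ S) :
    ∑ r ∈ S, posSign R S r * T j r * pfSub T (S.erase r) = 0 := by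
  rw [← add_sum_erase _ _ hj, hdiag, mul_zero, zero_mul, zero_add]
  have hexpand : ∀ r ∈ S.erase j, posSign R S r * T j r * pfSub T (S.erase r) =
      ∑ b ∈ (S.erase j).erase r, posSign R S r * T j r * (posSign R (S.erase r) j *
        (posSign R ((S.erase r).erase j) b * T j b * pfSub T (((S.erase r).erase j).erase b))) := by
    intro r hr
    obtain ⟨hrj, hr⟩ := mem_erase.mp hr
    have heven : Even #(S.erase r) := by
      rw [card_erase_of_mem hr]
      exact Nat.Odd.sub_odd hS odd_one
    rw [pfSub_eq_sum T hskew heven (mem_erase.mpr ⟨hrj.symm, hj⟩), erase_right_comm (a := j),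
      mul_sum, mul_sum]
  rw [sum_congr rfl hexpand]
  refine sum_sum_erase_eq_zero _ _ fun r hr b hb hrb => ?_
  obtain ⟨hrj, hrS⟩ := mem_erase.mp hr
  obtain ⟨hbj, hbS⟩ := mem_erase.mp hb
  have hset : ((S.erase b).erase j).erase r = ((S.erase r).erase j).erase b := by
    ext x; simp only [mem_erase]; tauto
  rw [hset, posSign_erase (y := j) (x := b) (by simp [*, hrj.symm]),
    posSign_erase (y := j) (x := r) (by simp [*, hbj.symm]), posSign_erase hrS, posSign_erase hrS,
    posSign_erase hbS, posSign_erase hbS, orderSign_swap hrb, orderSign_swap hrj,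
    orderSign_swap hbj]
  ring

end Finset

lemma neg_one_pow_theta {R : Type*} [CommRing R] {m : ℕ} (x y : Fin m) :
    (-1 : R) ^ theta (((x : ℕ) + 1 : ℕ) - ((y : ℕ) + 1 : ℕ)) = orderSign R x y := by
  have : (0 : ℤ) < (((x : ℕ) + 1 : ℕ) - ((y : ℕ) + 1 : ℕ)) ↔ y < x := by omega
  simp only [theta, orderSign, this]
  split_ifs <;> simp

lemma posSign_univ {R : Type*} [CommRing R] {m : ℕ} (x : Fin m) :
    posSign R univ x = (-1) ^ (x : ℕ) := by
  rw [posSign, filter_gt_eq_Iio, Fin.card_Iio]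

/-- Knuth-type pfaffian identity: for a skew-symmetric `m × m` matrix `T` (`m` odd) with zero
diagonal, and `i, h, s, k, j ∈ {1,…,m}` with `j ∉ {i,h,s,k}` (encoded in `Fin m`, an element
`a` carrying the 1-based label `a + 1`):
`Σ_{r=1}^{m} σ_{i,r,h} · σ_{i,r,h,s,k} · T_{j,r} · pf_{î,r̂,ĥ,ŝ,k̂}(T) = 0`. -/
theorem sum_sigma5_mul_pf_eq_zero {R : Type*} [CommRing R] (m : ℕ) (hodd : Odd m) (hpos : 0 < m)
    (T : Matrix (Fin m) (Fin m) R)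
    (hskew : ∀ a b, T b a = - T a b) (hdiag : ∀ a, T a a = 0)
    (i h s k j : Fin m) (hji : j ≠ i) (hjh : j ≠ h) (hjs : j ≠ s) (hjk : j ≠ k) :
    ∑ r : Fin m,
      ((sigma3 ((i : ℕ) + 1) ((r : ℕ) + 1) ((h : ℕ) + 1) : ℤ) : R) *
      ((sigma5 ((i : ℕ) + 1) ((r : ℕ) + 1) ((h : ℕ) + 1) ((s : ℕ) + 1) ((k : ℕ) + 1) : ℤ) : R) *
      T j r * pfDel T [i, r, h, s, k] = 0 := by
  by_cases hne : i ≠ h ∧ i ≠ s ∧ i ≠ k ∧ h ≠ s ∧ h ≠ k ∧ s ≠ k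
  swap
  · refine sum_eq_zero fun r _ => ?_
    rw [pfDel, if_neg, mul_zero]
    simp only [List.nodup_cons, List.mem_cons, List.not_mem_nil, List.nodup_nil]
    tauto
  obtain ⟨hih, his, hik, hhs, hhk, hsk⟩ := hne
  set S : Finset (Fin m) := (((univ.erase i).erase h).erase s).erase k with hS_def
  have hjS : j ∈ S := by simp [hS_def, hji, hjh, hjs, hjk]
  have hodd' : Odd #S := by
    rw [hS_def, card_erase_of_mem (by simp [hik.symm, hhk.symm, hsk.symm]),
      card_erase_of_mem (by simp [his.symm, hhs.symm]), card_erase_of_mem (by simp [hih.symm]),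
      card_erase_of_mem (mem_univ i), card_univ, Fintype.card_fin]
    have hcard : 0 < #S := card_pos.mpr ⟨j, hjS⟩
    rw [hS_def, card_erase_of_mem (by simp [hik.symm, hhk.symm, hsk.symm]),
      card_erase_of_mem (by simp [his.symm, hhs.symm]), card_erase_of_mem (by simp [hih.symm]),
      card_erase_of_mem (mem_univ i), card_univ, Fintype.card_fin] at hcard
    grind
  rw [← sum_subset (subset_univ S)]
  swap
  · intro r _ hr
    rw [pfDel, if_neg, mul_zero]
    simp only [hS_def, mem_erase, mem_univ] at hr
    simp only [List.nodup_cons, List.mem_cons, List.not_mem_nil, List.nodup_nil]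
    tauto
  rw [← mul_zero ((-1) ^ ((i : ℕ) + h + s + k) * orderSign R h i * orderSign R k i *
    orderSign R k h * orderSign R k s * orderSign R s i * orderSign R s h),
    ← sum_posSign_mul_pfSub_erase_eq_zero T hskew hdiag hodd' hjS, mul_sum]
  refine sum_congr rfl fun r hr => ?_
  obtain ⟨hrk, hrs, hrh, hri, -⟩ : r ≠ k ∧ r ≠ s ∧ r ≠ h ∧ r ≠ i ∧ r ∈ univ := by
    simpa only [hS_def, mem_erase] using hr
  have hpf : pfDel T [i, r, h, s, k] = pfSub T (S.erase r) := by
    rw [pfDel, if_pos]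
    · congr 1
      ext x
      simp [hS_def]
      tauto
    · simp [*, hri.symm]
  have hpos : posSign R S r = (-1) ^ (r : ℕ) * orderSign R r i * orderSign R r h *
      orderSign R r s * orderSign R r k := by
    rw [hS_def, posSign_erase (by simp [hik.symm, hhk.symm, hsk.symm]),
      posSign_erase (by simp [his.symm, hhs.symm]), posSign_erase (by simp [hih.symm]),
      posSign_erase (mem_univ i), posSign_univ]
  have h3 : ((sigma3 ((i : ℕ) + 1) ((r : ℕ) + 1) ((h : ℕ) + 1) : ℤ) : R) =
      (-1) ^ (((i : ℕ) + 1) + ((r : ℕ) + 1) + ((h : ℕ) + 1) + 1) * orderSign R h i *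
        orderSign R h r * orderSign R r i := by
    rw [sigma3, if_pos (by simp [Fin.val_inj, *, hri.symm])]
    push_cast
    simp only [pow_add _ _ (theta _), ← neg_one_pow_theta]
    push_cast
    rfl
  have h5 : ((sigma5 ((i : ℕ) + 1) ((r : ℕ) + 1) ((h : ℕ) + 1) ((s : ℕ) + 1) ((k : ℕ) + 1) : ℤ) :
      R) = (-1) ^ (((s : ℕ) + 1) + ((k : ℕ) + 1) + 1) * orderSign R k i * orderSign R k r *
        orderSign R k h * orderSign R k s * orderSign R s i * orderSign R s r *
        orderSign R s h := by
    rw [sigma5, if_pos (by simp [Fin.val_inj, *, hri.symm])]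
    push_cast
    simp only [pow_add _ _ (theta _), ← neg_one_pow_theta]
    push_cast
    rfl
  rw [h3, h5, hpf, hpos, orderSign_swap hrk, orderSign_swap hrs, orderSign_swap hrh]
  ring
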